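/- Let a ≥ 1, b ≥ 0, let L = U^a ⊕ E₈(−1)^b and M = L ⊕ U, where the last hyperbolic summand U has basis f, e with ⟨f,f⟩ = ⟨e,e⟩ = 0 and ⟨f,e⟩ = 1. Let R₀ = {δ ∈ M : ⟨δ,δ⟩ = −2, ⟨δ,e⟩ = 0}, R₁ = {δ ∈ M : ⟨δ,δ⟩ = −2, ⟨δ,e⟩ = 1}, and let Γ₁ be the subgroup of O(M) generated by −id and the reflections s_δ(x) = x + ⟨x,δ⟩δ for δ ∈ R₁. Then every vector δ ∈ M with ⟨δ,δ⟩ = −2 is conjugate under Γ₁ to an element of R₀ ∪ R₁. -/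

import Mathlib

noncomputable section

open scoped BigOperators

/-- Index type for the even unimodular lattice `L = U^a ⊕ E₈(-1)^b`. -/
abbrev LIdx (a b : ℕ) := (Fin a × Fin 2) ⊕ (Fin b × Fin 8)

/-- Elements of the lattice `L = U^a ⊕ E₈(-1)^b`. -/
abbrev LVec (a b : ℕ) := LIdx a b → ℤ

/-- The Gram matrix of `U^a ⊕ E₈(-1)^b`. -/
def gramL (a b : ℕ) : LIdx a b → LIdx a b → ℤ := fun i j =>
  match i, j with
  | Sum.inl (k, s), Sum.inl (k', s') => if k = k' ∧ s ≠ s' then 1 else 0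
  | Sum.inr (k, s), Sum.inr (k', s') => if k = k' then -(CartanMatrix.E₈ s s') else 0
  | _, _ => 0

/-- The bilinear form of `L = U^a ⊕ E₈(-1)^b`. -/
def BL (a b : ℕ) (x y : LVec a b) : ℤ :=
  ∑ i, ∑ j, x i * gramL a b i j * y j

/-- Index type for `M = L ⊕ U`; the extra hyperbolic summand has basis `f = inr 0`,
`e = inr 1`.  An element `v + m f + n e` of `M` is the function sending `inl i` to `v i`,
`inr 0` to `m` and `inr 1` to `n`. -/
abbrev MIdx (a b : ℕ) := LIdx a b ⊕ Fin 2

/-- Elements of `M = L ⊕ U`. -/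
abbrev MVec (a b : ℕ) := MIdx a b → ℤ

/-- The bilinear form of `M = L ⊕ U`: `⟨v + m f + n e, v' + m' f + n' e⟩
  = ⟨v,v'⟩_L + m n' + n m'`. -/
def BM (a b : ℕ) (x y : MVec a b) : ℤ :=
  BL a b (fun i => x (Sum.inl i)) (fun i => y (Sum.inl i)) +
    x (Sum.inr 0) * y (Sum.inr 1) + x (Sum.inr 1) * y (Sum.inr 0)

/-- The basis vector `e` of the last hyperbolic summand of `M = L ⊕ U`. -/
def eM (a b : ℕ) : MVec a b := fun i => if i = Sum.inr 1 then 1 else 0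

/-- The subgroup `Γ₁` of `O(M)` generated by `-id` and the reflections
`s_δ : x ↦ x + ⟨x,δ⟩δ` in the elements `δ` of `R₁ = {δ : ⟨δ,δ⟩ = -2, ⟨δ,e⟩ = 1}`. -/
def Gamma1 (a b : ℕ) : Subgroup (MVec a b ≃ₗ[ℤ] MVec a b) :=
  Subgroup.closure
    ({σ | ∀ x, σ x = -x} ∪
      {σ | ∃ δ : MVec a b, BM a b δ δ = -2 ∧ BM a b δ (eM a b) = 1 ∧
        ∀ x, σ x = x + BM a b x δ • δ})

/-- The Gram matrix of `L` is symmetric. -/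
lemma gramL_comm (a b : ℕ) (i j : LIdx a b) : gramL a b i j = gramL a b j i := by
  have hE : ∀ s t : Fin 8, CartanMatrix.E₈ s t = CartanMatrix.E₈ t s := by
    intro s t
    fin_cases s <;> fin_cases t <;> rfl
  rcases i with ⟨k, s⟩ | ⟨k, s⟩ <;> rcases j with ⟨k', s'⟩ | ⟨k', s'⟩ <;>
    simp [gramL, eq_comm, hE]

/-- The form of `L` as a bilinear map. -/
def bilinL (a b : ℕ) : LinearMap.BilinForm ℤ (LVec a b) :=
  Matrix.toBilin' (Matrix.of (gramL a b))

lemma bilinL_apply (a b : ℕ) (x y : LVec a b) : bilinL a b x y = BL a b x y := by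
  simp [bilinL, BL, Matrix.toBilin'_apply]

lemma BL_comm (a b : ℕ) (x y : LVec a b) : BL a b x y = BL a b y x := by
  unfold BL
  rw [Finset.sum_comm]
  refine Finset.sum_congr rfl fun i _ => Finset.sum_congr rfl fun j _ => ?_
  rw [gramL_comm a b j i]
  ring

/-- The form of `M` as a bilinear map. -/
def bilinM (a b : ℕ) : LinearMap.BilinForm ℤ (MVec a b) :=
  LinearMap.mk₂ ℤ (BM a b)
    (fun x y z => by
      have := LinearMap.map_add₂ (bilinL a b) (fun i => x (Sum.inl i)) (fun i => y (Sum.inl i))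
        (fun i => z (Sum.inl i))
      simp only [bilinL_apply] at this
      simp only [BM, Pi.add_apply]
      linear_combination this)
    (fun c x z => by
      have := LinearMap.map_smul₂ (bilinL a b) c (fun i => x (Sum.inl i))
        (fun i => z (Sum.inl i))
      simp only [bilinL_apply, smul_eq_mul] at this
      simp only [BM, Pi.smul_apply, smul_eq_mul]
      linear_combination this)
    (fun z x y => by
      have := map_add (bilinL a b (fun i => z (Sum.inl i))) (fun i => x (Sum.inl i))
        (fun i => y (Sum.inl i))
      simp only [bilinL_apply] at this
      simp only [BM, Pi.add_apply]
      linear_combination this)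
    (fun c z x => by
      have := map_smul (bilinL a b (fun i => z (Sum.inl i))) c (fun i => x (Sum.inl i))
      simp only [bilinL_apply, smul_eq_mul] at this
      simp only [BM, Pi.smul_apply, smul_eq_mul]
      linear_combination this)

lemma bilinM_apply (a b : ℕ) (x y : MVec a b) : bilinM a b x y = BM a b x y := rfl

lemma BM_comm (a b : ℕ) (x y : MVec a b) : BM a b x y = BM a b y x := by
  unfold BM
  rw [BL_comm]
  ring

lemma BM_eM (a b : ℕ) (x : MVec a b) : BM a b x (eM a b) = x (Sum.inr 0) := by
  have h : BL a b (fun i => x (Sum.inl i)) (fun _ => 0) = 0 := by simp [BL]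
  simp [BM, eM, h]

/-- The reflection in a vector of norm `-2`, applied to a vector, preserves its norm. -/
lemma BM_reflection (a b : ℕ) {d : MVec a b} (hd : BM a b d d = -2) (x : MVec a b) :
    BM a b (x + BM a b x d • d) (x + BM a b x d • d) = BM a b x x := by
  have h := BM_comm a b d x
  simp only [← bilinM_apply] at hd h ⊢
  simp only [map_add, map_smul, LinearMap.add_apply, LinearMap.smul_apply, smul_eq_mul, h, hd]
  ring

/-- The reflection in an element of `R₁` belongs to `Γ₁`. -/
lemma exists_reflection_mem_Gamma1 (a b : ℕ) {d : MVec a b} (hd : BM a b d d = -2)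
    (he : BM a b d (eM a b) = 1) :
    ∃ σ ∈ Gamma1 a b, ∀ x, σ x = x + BM a b x d • d := by
  have h2 : (-(bilinM a b).flip d) d = 2 := by
    simp [bilinM_apply, hd]
  have hσ : ∀ x, Module.reflection h2 x = x + BM a b x d • d := fun x => by
    simp [Module.reflection_apply, bilinM_apply]
  exact ⟨Module.reflection h2, Subgroup.subset_closure (Or.inr ⟨d, hd, he, hσ⟩), hσ⟩

/-- The root `α E + β F + f - (1 + α β) e` of `M`, where `E, F` is the standard basis of the
`k`-th hyperbolic summand of `L`. -/
def hypRoot (a b : ℕ) (k : Fin a) (α β : ℤ) : MVec a b :=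
  Sum.elim (Pi.single (Sum.inl (k, 0)) α + Pi.single (Sum.inl (k, 1)) β) ![1, -1 - α * β]

lemma BL_hyp (a b : ℕ) (k : Fin a) (α β : ℤ) (x : LVec a b) :
    BL a b x (Pi.single (Sum.inl (k, 0)) α + Pi.single (Sum.inl (k, 1)) β) =
      x (Sum.inl (k, 0)) * β + x (Sum.inl (k, 1)) * α := by
  simp [BL, mul_add, Finset.sum_add_distrib, Pi.single_apply, gramL, Fintype.sum_prod_type, ite_and]
  ring

lemma BM_hypRoot (a b : ℕ) (k : Fin a) (α β : ℤ) (x : MVec a b) :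
    BM a b x (hypRoot a b k α β) =
      x (Sum.inl (Sum.inl (k, 0))) * β + x (Sum.inl (Sum.inl (k, 1))) * α +
        x (Sum.inr 0) * (-1 - α * β) + x (Sum.inr 1) := by
  have h := BL_hyp a b k α β (fun i => x (Sum.inl i))
  simp only [BM, hypRoot, Sum.elim_inl, Sum.elim_inr, Matrix.cons_val_zero, Matrix.cons_val_one,
    mul_one]
  rw [← h]

/-- For `m ≠ 0` one can choose `α, β` so that `p β + q α - m α β + n` is smaller than `m`. -/
lemma exists_natAbs_lt (m n p q : ℤ) (hm : m ≠ 0) :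
    ∃ α β : ℤ, (p * β + q * α - m * α * β + n).natAbs < m.natAbs := by
  obtain ⟨α, hne, hle⟩ : ∃ α : ℤ, p - m * α ≠ 0 ∧ |p - m * α| ≤ |m| := by
    by_cases hr : p % m = 0
    · refine ⟨p / m - 1, ?_⟩
      have : p - m * (p / m - 1) = m := by
        linear_combination hr - Int.mul_ediv_add_emod p m
      rw [this]
      exact ⟨hm, le_rfl⟩
    · refine ⟨p / m, ?_⟩
      have : p - m * (p / m) = p % m := by
        linear_combination - Int.mul_ediv_add_emod p m
      rw [this, abs_of_nonneg (Int.emod_nonneg p hm)]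
      exact ⟨hr, (Int.emod_lt_abs p hm).le⟩
  refine ⟨α, -((q * α + n) / (p - m * α)), ?_⟩
  have h : p * -((q * α + n) / (p - m * α)) + q * α - m * α * -((q * α + n) / (p - m * α)) + n
      = (q * α + n) % (p - m * α) := by
    linear_combination - Int.mul_ediv_add_emod (q * α + n) (p - m * α)
  rw [h]
  have h0 := Int.emod_nonneg (q * α + n) hne
  have h1 := Int.emod_lt_abs (q * α + n) hne
  zify
  rw [abs_of_nonneg h0]
  exact h1.trans_le hle

/-- Every vector of `M` is conjugate under `Γ₁` to a vector of the same norm orthogonal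
to `e`. -/
lemma exists_Gamma1_orthogonal (a b : ℕ) (k : Fin a) (x : MVec a b) :
    ∃ γ ∈ Gamma1 a b, BM a b (γ x) (γ x) = BM a b x x ∧ BM a b (γ x) (eM a b) = 0 := by
  induction hN : (x (Sum.inr 0)).natAbs using Nat.strong_induction_on generalizing x with
  | _ N ih =>
    subst hN
    by_cases hm : x (Sum.inr 0) = 0
    · exact ⟨1, one_mem _, rfl, by rw [BM_eM]; exact hm⟩
    obtain ⟨α, β, hlt⟩ := exists_natAbs_lt (x (Sum.inr 0)) (x (Sum.inr 1))
      (x (Sum.inl (Sum.inl (k, 0)))) (x (Sum.inl (Sum.inl (k, 1)))) hm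
    have hd : BM a b (hypRoot a b k α β) (hypRoot a b k α β) = -2 := by
      rw [BM_hypRoot]
      simp [hypRoot]
      ring
    have he : BM a b (hypRoot a b k α β) (eM a b) = 1 := by
      rw [BM_eM]
      simp [hypRoot]
    obtain ⟨σ, hσ, hσx⟩ := exists_reflection_mem_Gamma1 a b hd he
    have hcoord : σ x (Sum.inr 0) = x (Sum.inl (Sum.inl (k, 0))) * β +
        x (Sum.inl (Sum.inl (k, 1))) * α - x (Sum.inr 0) * α * β + x (Sum.inr 1) := by
      rw [hσx, BM_hypRoot]
      simp [hypRoot]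
      ring
    obtain ⟨γ, hγ, hnorm, horth⟩ := ih _ (by rw [← hcoord] at hlt; exact hlt) (σ x) rfl
    refine ⟨γ * σ, mul_mem hγ hσ, ?_, horth⟩
    rw [LinearEquiv.mul_apply, hnorm, hσx, BM_reflection a b hd]

/-- Every norm `-2` vector of `M = L ⊕ U` is conjugate under `Γ₁` to an element of
`R₀ ∪ R₁`, i.e. to a norm `-2` vector `δ'` with `⟨δ',e⟩ = 0` or `⟨δ',e⟩ = 1`. -/
theorem statement10 (a b : ℕ) (ha : 1 ≤ a) (δ : MVec a b) (hδ : BM a b δ δ = -2) :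
    ∃ γ ∈ Gamma1 a b,
      BM a b (γ δ) (γ δ) = -2 ∧ (BM a b (γ δ) (eM a b) = 0 ∨ BM a b (γ δ) (eM a b) = 1) := by
  obtain ⟨γ, hγ, hnorm, horth⟩ := exists_Gamma1_orthogonal a b ⟨0, ha⟩ δ
  exact ⟨γ, hγ, hnorm.trans hδ, Or.inl horth⟩
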